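/- arXiv:1301.3400 — 3 statements merged into one kernel-verified Lean document; each statement's English description precedes it below -/
import Mathlib

section
/- For n ≥ 4, the symmetric group Sₙ has the presentation with two generators σ, τ and relations σ² = e, (στστ⁻¹)³ = e, (στ^m σ τ^{−m})² = e for 2 ≤ m ≤ n − 2, and (στ)^{n−1} = τⁿ. That is, the group presented by these generators and relations is isomorphic to Sₙ, via the map sending σ to the transposition (1 2) and τ to the n-cycle sending k to k − 1 mod n. -/
/-- The relators for the presentation of the symmetric group `Sₙ` on two
generators `σ` (encoded `true`) and `τ` (encoded `false`):
`σ² = e`, `(στστ⁻¹)³ = e`, `(στ^m στ^{-m})² = e` for `2 ≤ m ≤ n - 2`, and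
`(στ)^{n-1} = τⁿ`. -/
def symRels (n : ℕ) : Set (FreeGroup Bool) :=
  {(FreeGroup.of true) ^ 2,
   (FreeGroup.of true * FreeGroup.of false * FreeGroup.of true *
      (FreeGroup.of false)⁻¹) ^ 3,
   (FreeGroup.of true * FreeGroup.of false) ^ (n - 1) * ((FreeGroup.of false) ^ n)⁻¹} ∪
  {r | ∃ m : ℕ, 2 ≤ m ∧ m ≤ n - 2 ∧
      r = (FreeGroup.of true * (FreeGroup.of false) ^ m * FreeGroup.of true *
            ((FreeGroup.of false) ^ m)⁻¹) ^ 2}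


/-- Descending words `s_{k-1} s_{k-2} ⋯` of length `d`. -/
def descW {G : Type*} [Group G] (s : ℕ → G) : ℕ → ℕ → G
  | 0, _ => 1
  | _ + 1, 0 => 1
  | k + 1, d + 1 => s k * descW s k d

theorem descW_zero {G : Type*} [Group G] (s : ℕ → G) (k : ℕ) : descW s k 0 = 1 := by
  cases k <;> rfl

theorem descW_comm {G : Type*} [Group G] (s : ℕ → G) (N : ℕ)
    (hcomm : ∀ i j, i + 2 ≤ j → j < N → s j * s i = s i * s j) (j : ℕ) (hj : j < N) :
    ∀ k d, k < j → s j * descW s k d = descW s k d * s j := by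
  intro k
  induction k with
  | zero => intro d _; simp [descW]
  | succ k ih =>
    intro d hk
    cases d with
    | zero => simp [descW]
    | succ d =>
      simp only [descW]
      rw [← mul_assoc, hcomm k j (by omega) hj, mul_assoc, ih d (by omega), mul_assoc]

theorem descW_mul {G : Type*} [Group G] (s : ℕ → G) (N : ℕ)
    (hsq : ∀ i, i < N → s i * s i = 1)
    (hbr : ∀ i, i + 1 < N → s (i+1) * s i * s (i+1) = s i * s (i+1) * s i)
    (hcomm : ∀ i j, i + 2 ≤ j → j < N → s j * s i = s i * s j) :
    ∀ k, k ≤ N → ∀ d, d ≤ k → ∀ i, i < k → ∃ d' ≤ k,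
      descW s k d * s i = descW s k d' ∨
      ∃ i', i' + 1 < k ∧ descW s k d * s i = s i' * descW s k d' := by
  intro k
  induction k with
  | zero => intro _ d _ i hi; omega
  | succ k ih =>
    intro hk d hd i hi
    cases d with
    | zero =>
      rcases Nat.lt_or_ge i k with h | h
      · exact ⟨0, by omega, Or.inr ⟨i, by omega, by simp [descW]⟩⟩
      · obtain rfl : i = k := by omega
        exact ⟨1, by omega, Or.inl (by simp [descW, descW_zero])⟩
    | succ d =>
      rcases Nat.lt_or_ge i k with h | h
      · obtain ⟨d', hd', h1 | ⟨i', hi', h1⟩⟩ := ih (by omega) d (by omega) i h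
        · exact ⟨d' + 1, by omega, Or.inl (by simp only [descW]; rw [mul_assoc, h1])⟩
        · refine ⟨d' + 1, by omega, Or.inr ⟨i', by omega, ?_⟩⟩
          simp only [descW]
          rw [mul_assoc, h1, ← mul_assoc, hcomm i' k (by omega) (by omega), mul_assoc]
      · obtain rfl : i = k := by omega
        cases d with
        | zero => exact ⟨0, by omega, Or.inl (by simp [descW, descW_zero, hsq i (by omega)])⟩
        | succ d =>
          cases i with
          | zero => omega
          | succ k =>
            refine ⟨d + 1 + 1, by omega, Or.inr ⟨k, by omega, ?_⟩⟩
            simp only [descW]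
            rw [mul_assoc, mul_assoc, ← descW_comm s N hcomm (k+1) (by omega) k d (by omega),
              ← mul_assoc, ← mul_assoc, hbr k (by omega)]
            simp only [mul_assoc]

open Classical in
/-- Normal forms. -/
noncomputable def nfW {G : Type*} [Group G] (s : ℕ → G) : ℕ → Finset G
  | 0 => {1}
  | k + 1 => (nfW s k ×ˢ Finset.range (k + 2)).image fun p => p.1 * descW s (k+1) p.2

theorem nfW_card {G : Type*} [Group G] (s : ℕ → G) (k : ℕ) :
    (nfW s k).card ≤ (k+1).factorial := by
  induction k with
  | zero => simp [nfW]
  | succ k ih =>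
    classical
    rw [nfW]
    refine Finset.card_image_le.trans ?_
    rw [Finset.card_product, Finset.card_range, Nat.factorial_succ (k+1), mul_comm]
    exact Nat.mul_le_mul_left _ ih

theorem nfW_one {G : Type*} [Group G] (s : ℕ → G) (k : ℕ) : (1 : G) ∈ nfW s k := by
  induction k with
  | zero => simp [nfW]
  | succ k ih =>
    classical
    rw [nfW, Finset.mem_image]
    exact ⟨(1, 0), by simp [ih], by simp [descW]⟩

theorem nfW_mul {G : Type*} [Group G] (s : ℕ → G) (N : ℕ)
    (hsq : ∀ i, i < N → s i * s i = 1)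
    (hbr : ∀ i, i + 1 < N → s (i+1) * s i * s (i+1) = s i * s (i+1) * s i)
    (hcomm : ∀ i j, i + 2 ≤ j → j < N → s j * s i = s i * s j) :
    ∀ k, k ≤ N → ∀ i, i < k → ∀ g ∈ nfW s k, g * s i ∈ nfW s k := by
  intro k
  induction k with
  | zero => intro _ i hi; omega
  | succ k ih =>
    intro hk i hi g hg
    classical
    rw [nfW, Finset.mem_image] at hg ⊢
    obtain ⟨⟨a, d⟩, had, rfl⟩ := hg
    simp only [Finset.mem_product, Finset.mem_range] at had
    obtain ⟨d', hd', h1 | ⟨i', hi', h1⟩⟩ :=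
      descW_mul s N hsq hbr hcomm (k+1) hk d (by omega) i hi
    · refine ⟨(a, d'), ?_, ?_⟩
      · simp only [Finset.mem_product, Finset.mem_range]; exact ⟨had.1, by omega⟩
      · simp only [mul_assoc, h1]
    · refine ⟨(a * s i', d'), ?_, ?_⟩
      · simp only [Finset.mem_product, Finset.mem_range]
        exact ⟨ih (by omega) i' (by omega) a had.1, by omega⟩
      · simp only [mul_assoc, h1]

/-- Upper bound for a group generated by elements satisfying the braid relations. -/
theorem card_bound {G : Type*} [Group G] (s : ℕ → G) (N : ℕ)
    (hsq : ∀ i, i < N → s i * s i = 1)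
    (hbr : ∀ i, i + 1 < N → s (i+1) * s i * s (i+1) = s i * s (i+1) * s i)
    (hcomm : ∀ i j, i + 2 ≤ j → j < N → s j * s i = s i * s j)
    (hgen : Subgroup.closure (s '' Set.Iio N) = ⊤) :
    Finite G ∧ Nat.card G ≤ (N+1).factorial := by
  have hall : ∀ g : G, g ∈ nfW s N := by
    intro g
    have hg : g ∈ Subgroup.closure (s '' Set.Iio N) := by rw [hgen]; trivial
    induction hg using Subgroup.closure_induction_right with
    | one => exact nfW_one s N
    | mul_right x hx y hy h =>
      obtain ⟨i, hi, rfl⟩ := hy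
      exact nfW_mul s N hsq hbr hcomm N le_rfl i hi _ h
    | mul_inv_cancel x hx y hy h =>
      obtain ⟨i, hi, rfl⟩ := hy
      rw [inv_eq_of_mul_eq_one_right (hsq i hi)]
      exact nfW_mul s N hsq hbr hcomm N le_rfl i hi _ h
  have hu : (Set.univ : Set G) = ↑(nfW s N) := by ext; simp [hall]
  refine ⟨Set.finite_univ_iff.mp (hu ▸ Finset.finite_toSet _), ?_⟩
  rw [← Set.ncard_univ, hu, Set.ncard_coe_finset]
  exact nfW_card s N

theorem group_part {G : Type*} [Group G] (n : ℕ) (hn : 4 ≤ n) (σ τ : G)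
    (h2 : σ ^ 2 = 1) (h3 : (σ * τ * σ * τ⁻¹) ^ 3 = 1)
    (hl : (σ * τ) ^ (n - 1) = τ ^ n)
    (hm : ∀ m, 2 ≤ m → m ≤ n - 2 → (σ * τ ^ m * σ * (τ ^ m)⁻¹) ^ 2 = 1)
    (hgen : ∀ K : Subgroup G, σ ∈ K → τ ∈ K → K = ⊤) :
    Finite G ∧ Nat.card G ≤ n.factorial := by
  obtain ⟨N, rfl⟩ : ∃ N, n = N + 1 := ⟨n - 1, by omega⟩
  have hσ : σ * σ = 1 := by rw [← pow_two, h2]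
  have hσi : σ⁻¹ = σ := inv_eq_of_mul_eq_one_right hσ
  have hprod : ∀ m, (σ * τ) ^ m * (τ ^ m)⁻¹ ∈
      Subgroup.closure ((fun i => τ ^ i * σ * (τ ^ i)⁻¹) '' Set.Iio m) := by
    intro m
    induction m with
    | zero => simp
    | succ m ih =>
      have e : (σ * τ) ^ (m+1) * (τ ^ (m+1))⁻¹ =
        ((σ * τ) ^ m * (τ ^ m)⁻¹) * (τ ^ m * σ * (τ ^ m)⁻¹) := by
        rw [pow_succ, pow_succ]; group
      rw [e]
      refine mul_mem (Subgroup.closure_mono (Set.image_mono ?_) ih)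
        (Subgroup.subset_closure ⟨m, by simp, rfl⟩)
      intro x hx; simp at hx ⊢; omega
  refine card_bound (fun i => τ ^ i * σ * (τ ^ i)⁻¹) N ?_ ?_ ?_ ?_
  · intro i _
    calc τ ^ i * σ * (τ ^ i)⁻¹ * (τ ^ i * σ * (τ ^ i)⁻¹) = τ ^ i * (σ * σ) * (τ ^ i)⁻¹ := by group
      _ = 1 := by rw [hσ]; group
  · intro i _
    have h3' : (τ * σ * τ⁻¹) * σ * (τ * σ * τ⁻¹) = σ * (τ * σ * τ⁻¹) * σ := by
      have hi : (τ * σ * τ⁻¹)⁻¹ = τ * σ * τ⁻¹ := by rw [mul_inv_rev, mul_inv_rev, hσi]; group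
      generalize hρ : τ * σ * τ⁻¹ = ρ at *
      have h : (σ * ρ) ^ 3 = 1 := by rw [← hρ, ← h3]; congr 1; group
      have : (ρ * σ * ρ) * (σ * ρ * σ)⁻¹ = 1 := by
        rw [mul_inv_rev, mul_inv_rev, hσi, hi]
        have : σ * ((ρ * σ * ρ) * (σ * (ρ * σ))) * σ⁻¹ = 1 := by
          rw [hσi]
          calc _ = (σ * ρ)^3 * (σ * σ) := by simp only [pow_succ, pow_zero, one_mul, mul_assoc]
            _ = 1 := by rw [h, hσ, one_mul]
        exact conj_eq_one_iff.mp this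
      exact mul_inv_eq_one.mp this
    calc _ = τ ^ i * ((τ * σ * τ⁻¹) * σ * (τ * σ * τ⁻¹)) * (τ ^ i)⁻¹ := by
            simp only [pow_succ]; group
      _ = _ := by rw [h3']; simp only [pow_succ]; group
  · intro i j hij hj
    obtain ⟨m, rfl⟩ : ∃ m, j = i + m := ⟨j - i, by omega⟩
    have h := hm m (by omega) (by omega)
    have hi : (τ ^ m * σ * (τ ^ m)⁻¹)⁻¹ = τ ^ m * σ * (τ ^ m)⁻¹ := by
      rw [mul_inv_rev, mul_inv_rev, hσi, inv_inv, mul_assoc]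
    have hc : (τ ^ m * σ * (τ ^ m)⁻¹) * σ = σ * (τ ^ m * σ * (τ ^ m)⁻¹) := by
      have h' : (σ * (τ ^ m * σ * (τ ^ m)⁻¹)) * (σ * (τ ^ m * σ * (τ ^ m)⁻¹)) = 1 := by
        rw [← h, pow_two]; simp only [mul_assoc]
      rw [← inv_eq_of_mul_eq_one_right h', mul_inv_rev, hi, hσi]
    calc _ = τ ^ i * ((τ ^ m * σ * (τ ^ m)⁻¹) * σ) * (τ ^ i)⁻¹ := by
            simp only [pow_add]; group
      _ = _ := by rw [hc]; simp only [pow_add]; group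
  · refine hgen _ (Subgroup.subset_closure ⟨0, by simp; omega, by simp⟩) ?_
    have := hprod N
    rw [show N + 1 - 1 = N by omega] at hl
    rw [hl] at this
    convert this using 1
    rw [pow_succ']; group

section PermPart
open scoped Fin.CommRing Fin.NatCast

theorem rot_pow_apply (k m : ℕ) (x : Fin (k + 4)) :
    (((finRotate (k + 4)).symm : Equiv.Perm (Fin (k + 4))) ^ m) x = x - (m : Fin (k + 4)) := by
  induction m with
  | zero => simp
  | succ m ih =>
    rw [pow_succ', Equiv.Perm.mul_apply, ih, Equiv.symm_apply_eq, finRotate_apply]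
    push_cast
    ring

theorem perm_rel_three (k : ℕ) :
    (Equiv.swap (0 : Fin (k + 4)) 1 * (finRotate (k + 4)).symm * Equiv.swap (0 : Fin (k + 4)) 1 *
      ((finRotate (k + 4)).symm)⁻¹) ^ 3 = 1 := by
  have h0 : (finRotate (k + 4)).symm 0 = -1 := by
    rw [Equiv.symm_apply_eq, finRotate_apply]; ring
  have h1 : (finRotate (k + 4)).symm 1 = 0 := by
    rw [Equiv.symm_apply_eq, finRotate_apply]; ring
  rw [mul_assoc, mul_assoc, ← mul_assoc _ _ ((finRotate (k + 4)).symm)⁻¹,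
    ← Equiv.swap_apply_apply, h0, h1, Equiv.swap_comm (-1) 0]
  have h3 : (Equiv.swap (0 : Fin (k + 4)) 1 * Equiv.swap 0 (-1)).IsThreeCycle := by
    apply Equiv.Perm.isThreeCycle_swap_mul_swap_same
    · simp
    · intro h; simp [Fin.ext_iff, Fin.val_neg] at h
    · intro h
      have : (1 : Fin (k+4)) + 1 = 0 := by nth_rw 1 [h]; ring
      simp [Fin.ext_iff, Fin.val_add, Nat.mod_eq_of_lt] at this
  have := pow_orderOf_eq_one (Equiv.swap (0 : Fin (k + 4)) 1 * Equiv.swap 0 (-1))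
  rwa [h3.orderOf] at this

theorem perm_rel_comm (k m : ℕ) (hm : 2 ≤ m) (hm' : m ≤ k + 2) :
    (Equiv.swap (0 : Fin (k + 4)) 1 * (finRotate (k + 4)).symm ^ m *
      Equiv.swap (0 : Fin (k + 4)) 1 * ((finRotate (k + 4)).symm ^ m)⁻¹) ^ 2 = 1 := by
  rw [mul_assoc, mul_assoc, ← mul_assoc _ _ ((finRotate (k + 4)).symm ^ m)⁻¹,
    ← Equiv.swap_apply_apply, rot_pow_apply, rot_pow_apply]
  have hv : ((m : Fin (k+4)) : ℕ) = m := by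
    rw [Fin.val_natCast]; exact Nat.mod_eq_of_lt (by omega)
  have hm1 : (m : Fin (k+4)) ≠ 0 := by intro h; rw [h] at hv; simp at hv; omega
  have hm2 : (m : Fin (k+4)) ≠ 1 := by intro h; rw [h] at hv; simp at hv; omega
  have hm3 : (m : Fin (k+4)) + 1 ≠ 0 := by
    intro h
    have := congrArg Fin.val h
    rw [Fin.val_add, hv] at this
    simp at this
    rw [Nat.mod_eq_of_lt (by omega)] at this
    omega
  have hd : Equiv.Perm.Disjoint (Equiv.swap (0 : Fin (k + 4)) 1)
      (Equiv.swap (0 - (m : Fin (k+4))) (1 - (m : Fin (k+4)))) := by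
    intro x
    by_cases hx0 : x = 0
    · right; subst hx0
      apply Equiv.swap_apply_of_ne_of_ne
      · intro h; apply hm1; linear_combination h
      · intro h; exact hm2 (sub_eq_zero.mp h.symm).symm
    · by_cases hx1 : x = 1
      · right; subst hx1
        apply Equiv.swap_apply_of_ne_of_ne
        · intro h; apply hm3; rw [h]; ring
        · intro h; apply hm1; rw [← sub_sub_self 1 (m : Fin (k+4)), ← h]; ring
      · left; exact Equiv.swap_apply_of_ne_of_ne hx0 hx1
  rw [hd.commute.mul_pow]
  simp [pow_two]

theorem perm_rel_long (k : ℕ) :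
    (Equiv.swap (0 : Fin (k + 4)) 1 * (finRotate (k + 4)).symm) ^ (k + 3) =
      (finRotate (k + 4)).symm ^ (k + 4) := by
  have hr : ((finRotate (k + 4)).symm : Equiv.Perm (Fin (k + 4))) ^ (k + 4) = 1 := by
    ext x
    rw [rot_pow_apply, Fin.natCast_self]; simp
  rw [hr, ← inv_inj, ← inv_pow, inv_one, mul_inv_rev, Equiv.swap_inv]
  rw [show ((finRotate (k + 4)).symm : Equiv.Perm (Fin (k + 4)))⁻¹ = finRotate (k+4) from rfl]
  set f : Equiv.Perm (Fin (k + 4)) := finRotate (k + 4) * Equiv.swap 0 1 with hf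
  have hstep : ∀ x : Fin (k+4), x ≠ 0 → x ≠ 1 → f x = x + 1 := by
    intro x h0 h1
    rw [hf, Equiv.Perm.mul_apply, Equiv.swap_apply_of_ne_of_ne h0 h1, finRotate_apply]
  have hf0 : f 0 = 2 := by
    rw [hf, Equiv.Perm.mul_apply, Equiv.swap_apply_left, finRotate_apply, one_add_one_eq_two]
  have hf1 : f 1 = 1 := by
    rw [hf, Equiv.Perm.mul_apply, Equiv.swap_apply_right, finRotate_apply, zero_add]
  have horb : ∀ j, j ≤ k + 2 → (f ^ (j + 1)) 0 = ((j + 2 : ℕ) : Fin (k+4)) := by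
    intro j
    induction j with
    | zero => intro _; simpa using hf0
    | succ j ih =>
      intro hj
      rw [pow_succ', Equiv.Perm.mul_apply, ih (by omega), hstep]
      · push_cast; ring
      · intro h
        have := congrArg Fin.val h
        rw [Fin.val_natCast, Nat.mod_eq_of_lt (by omega)] at this
        simp at this
      · intro h
        have := congrArg Fin.val h
        rw [Fin.val_natCast, Nat.mod_eq_of_lt (by omega)] at this
        simp at this
  have h00 : (f ^ (k + 3)) 0 = 0 := by
    rw [horb (k+2) le_rfl]; exact Fin.natCast_self (k+4)
  have hpow : ∀ j, (f ^ (k + 3)) ((f ^ j) 0) = (f ^ j) 0 := by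
    intro j
    rw [← Equiv.Perm.mul_apply, ← pow_add, add_comm (k + 3) j, pow_add, Equiv.Perm.mul_apply, h00]
  apply Equiv.ext
  intro x
  rw [Equiv.Perm.one_apply]
  obtain ⟨v, hv⟩ := x
  match v, hv with
  | 0, _ => exact h00
  | 1, _ => exact Equiv.Perm.pow_apply_eq_self_of_apply_eq_self hf1 _
  | v + 2, hv =>
    have : (⟨v + 2, hv⟩ : Fin (k+4)) = (f ^ (v + 1)) 0 := by
      rw [horb v (by omega)]
      apply Fin.ext
      rw [Fin.val_natCast, Nat.mod_eq_of_lt hv]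
    rw [this]; exact hpow _

theorem perm_gen (k : ℕ) (K : Subgroup (Equiv.Perm (Fin (k + 4))))
    (h1 : Equiv.swap (0 : Fin (k + 4)) 1 ∈ K) (h2 : (finRotate (k + 4)).symm ∈ K) : K = ⊤ := by
  rw [eq_top_iff, ← Equiv.Perm.closure_cycle_adjacent_swap (isCycle_finRotate (n := k + 2))
    support_finRotate 0, Subgroup.closure_le]
  rintro x (rfl | hx)
  · have := K.inv_mem h2
    exact this
  · rw [Set.mem_singleton_iff] at hx
    rw [hx, finRotate_apply, zero_add]
    exact h1

end PermPart

/-- For `n ≥ 4`, the group presented by generators `σ, τ` and relations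
`σ² = e`, `(στστ⁻¹)³ = e`, `(στ^m στ^{-m})² = e` for `2 ≤ m ≤ n - 2`, and
`(στ)^{n-1} = τⁿ` is isomorphic to the symmetric group `Sₙ`, via the map
sending `σ` to the transposition `(1 2)` and `τ` to the `n`-cycle
`k ↦ k - 1 mod n`. -/
theorem stmt_5 (n : ℕ) (hn : 4 ≤ n) :
    ∃ e : PresentedGroup (symRels n) ≃* Equiv.Perm (Fin n),
      e (PresentedGroup.of true) =
        Equiv.swap (⟨0, by omega⟩ : Fin n) (⟨1, by omega⟩ : Fin n) ∧
      e (PresentedGroup.of false) = (finRotate n).symm := by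
  obtain ⟨k, rfl⟩ : ∃ k, n = k + 4 := ⟨n - 4, by omega⟩
  have hrel : ∀ r ∈ symRels (k + 4), PresentedGroup.mk (symRels (k + 4)) r = 1 := fun r hr =>
    PresentedGroup.one_of_mem hr
  have hG := group_part (k + 4) hn (PresentedGroup.of true : PresentedGroup (symRels (k + 4)))
    (PresentedGroup.of false)
    (hrel _ (Or.inl (Or.inl rfl)))
    (hrel _ (Or.inl (Or.inr (Or.inl rfl))))
    (mul_inv_eq_one.mp (hrel _ (Or.inl (Or.inr (Or.inr rfl)))))
    (fun m h1 h2 => hrel _ (Or.inr ⟨m, h1, h2, rfl⟩))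
    (by
      intro K h1 h2
      rw [eq_top_iff, ← PresentedGroup.closure_range_of, Subgroup.closure_le]
      rintro _ ⟨b, rfl⟩
      cases b
      · exact h2
      · exact h1)
  obtain ⟨hfin, hcard⟩ := hG
  let f : Bool → Equiv.Perm (Fin (k + 4)) := fun b =>
    if b then Equiv.swap 0 1 else (finRotate (k + 4)).symm
  have hf : ∀ r ∈ symRels (k + 4), FreeGroup.lift f r = 1 := by
    rintro r ((rfl | rfl | rfl) | ⟨m, h1, h2, rfl⟩)
    · simp [f, pow_two]
    · simpa [f] using perm_rel_three k
    · simp only [map_mul, map_pow, map_inv, FreeGroup.lift_apply_of]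
      exact mul_inv_eq_one.mpr (perm_rel_long k)
    · simp only [map_mul, map_pow, map_inv, FreeGroup.lift_apply_of]
      exact perm_rel_comm k m h1 h2
  let φ := PresentedGroup.toGroup hf
  have ht : φ (PresentedGroup.of true) = Equiv.swap 0 1 := PresentedGroup.toGroup.of hf
  have hfl : φ (PresentedGroup.of false) = (finRotate (k + 4)).symm := PresentedGroup.toGroup.of hf
  have hsurj : Function.Surjective φ :=
    MonoidHom.range_eq_top.mp (perm_gen k _ ⟨_, ht⟩ ⟨_, hfl⟩)
  have hbij : Function.Bijective φ := hsurj.bijective_of_nat_card_le (by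
    rw [Nat.card_perm, Nat.card_fin]; exact hcard)
  exact ⟨MulEquiv.ofBijective φ hbij, ht, hfl⟩
end

section
/- For n ≥ 4, the semidirect product ℤⁿ ⋊ Sₙ (with Sₙ permuting coordinates) has the presentation with two generators a, b and relations: b² = e, (baba⁻¹)³ = e, (ba^k b a^{−k})² = e for 2 ≤ k ≤ n − 2, and b aⁿ b a^{−n} = e. The isomorphism sends a to ((0, …, 0, 1), c), where c is the n-cycle c(k) = k − 1 mod n, and b to (0, (1 2)). -/
/-- The automorphism of `ℤ^α` (written multiplicatively) given by permuting
coordinates by `s`. -/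
def permMulAut {α : Type*} (s : Equiv.Perm α) : MulAut (Multiplicative (α → ℤ)) where
  toFun z := Multiplicative.ofAdd (Multiplicative.toAdd z ∘ ⇑s.symm)
  invFun z := Multiplicative.ofAdd (Multiplicative.toAdd z ∘ ⇑s)
  left_inv z := by simp [Function.comp_def]
  right_inv z := by simp [Function.comp_def]
  map_mul' z₁ z₂ := rfl

/-- The action of the symmetric group on `ℤ^α` by permuting coordinates,
as a homomorphism to the automorphism group. -/
def permHom (α : Type*) : Equiv.Perm α →* MulAut (Multiplicative (α → ℤ)) where
  toFun := permMulAut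
  map_one' := by ext z; rfl
  map_mul' s t := by ext z; rfl

/-- Relators on the two generators `a` (encoded `true`) and `b` (encoded
`false`): `b² = e`, `(baba⁻¹)³ = e`, `(ba^k b a^{-k})² = e` for `2 ≤ k ≤ n - 2`,
and `baⁿba^{-n} = e`. -/
def sdpRels2 (n : ℕ) : Set (FreeGroup Bool) :=
  letI a : FreeGroup Bool := FreeGroup.of true
  letI b : FreeGroup Bool := FreeGroup.of false
  {b ^ 2, (b * a * b * a⁻¹) ^ 3, b * a ^ n * b * (a ^ n)⁻¹} ∪
  {r | ∃ k : ℕ, 2 ≤ k ∧ k ≤ n - 2 ∧ r = (b * a ^ k * b * (a ^ k)⁻¹) ^ 2}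

namespace Stmt9

open Equiv

section Coxeter

variable {G : Type*} [Group G]

/-- `cyc s j d = s (j+d-1) * ... * s j`. -/
def cyc (s : ℕ → G) (j : ℕ) : ℕ → G
  | 0 => 1
  | d + 1 => s (j + d) * cyc s j d

/-- The subgroup generated by `s 0, ..., s (k-1)`. -/
def Hs (s : ℕ → G) (k : ℕ) : Subgroup G := Subgroup.closure {x | ∃ i < k, s i = x}

/-- Coxeter relations. -/
structure Cox (s : ℕ → G) (N : ℕ) : Prop where
  sq : ∀ i, s i * s i = 1
  braid : ∀ i, s i * s (i + 1) * s i = s (i + 1) * s i * s (i + 1)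
  comm : ∀ i j, i + 2 ≤ j → j < N → s i * s j = s j * s i

theorem Hs_mem (s : ℕ → G) {i k : ℕ} (h : i < k) : s i ∈ Hs s k :=
  Subgroup.subset_closure ⟨i, h, rfl⟩

theorem cyc_succ' (s : ℕ → G) (j d : ℕ) : cyc s j (d + 1) = cyc s (j + 1) d * s j := by
  induction d with
  | zero => simp [cyc]
  | succ d ih =>
    rw [cyc, ih, cyc, mul_assoc, show j + (d + 1) = j + 1 + d by ring]

theorem cyc_comm_low {s : ℕ → G} {N : ℕ} (hs : Cox s N) (i j d : ℕ) (hi : i + 2 ≤ j)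
    (hd : j + d ≤ N) : cyc s j d * s i = s i * cyc s j d := by
  induction d with
  | zero => simp [cyc]
  | succ d ih =>
    rw [cyc, mul_assoc, ih (by omega), ← mul_assoc, ← mul_assoc,
      hs.comm i (j + d) (by omega) (by omega)]

theorem cyc_shift {s : ℕ → G} {N : ℕ} (hs : Cox s N) (i j d : ℕ) (hi : j ≤ i)
    (hid : i + 1 < j + d) (hd : j + d ≤ N) :
    cyc s j d * s (i + 1) = s i * cyc s j d := by
  induction d with
  | zero => omega
  | succ d ih =>
    by_cases h : i + 1 < j + d
    · rw [cyc, mul_assoc, ih h (by omega), ← mul_assoc, ← mul_assoc,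
        hs.comm i (j + d) (by omega) (by omega)]
    · obtain ⟨e, rfl⟩ : ∃ e, d = e + 1 := ⟨d - 1, by omega⟩
      have hi' : i = j + e := by omega
      subst hi'
      have key : cyc s j e * s (j + e + 1) = s (j + e + 1) * cyc s j e := by
        clear ih h hid hi
        have : ∀ f, f ≤ e → cyc s j f * s (j + e + 1) = s (j + e + 1) * cyc s j f := by
          intro f hf
          induction f with
          | zero => simp [cyc]
          | succ f ih =>
            rw [cyc, mul_assoc, ih (by omega), ← mul_assoc, ← mul_assoc,
              hs.comm (j + f) (j + e + 1) (by omega) (by omega)]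
        exact this e le_rfl
      have b := hs.braid (j + e)
      rw [cyc, cyc, show j + (e + 1) = j + e + 1 by ring]
      rw [mul_assoc, mul_assoc, key]
      simp only [← mul_assoc]
      rw [b]

theorem decomp {s : ℕ → G} {N : ℕ} (hs : Cox s N) (k : ℕ) (hk : k + 1 ≤ N) {h : G}
    (hh : h ∈ Hs s (k + 1)) :
    ∃ j d, j + d = k + 1 ∧ ∃ h' ∈ Hs s k, h = h' * cyc s j d := by
  have step : ∀ x i, i < k + 1 → (∃ j d, j + d = k + 1 ∧ ∃ h' ∈ Hs s k, x = h' * cyc s j d) →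
      (∃ j d, j + d = k + 1 ∧ ∃ h' ∈ Hs s k, x * s i = h' * cyc s j d) := by
    rintro x i hi ⟨j, d, hjd, h', hh', rfl⟩
    rcases lt_trichotomy i j with hij | rfl | hij
    · by_cases h2 : i + 2 ≤ j
      · refine ⟨j, d, hjd, h' * s i, mul_mem hh' (Hs_mem s (by omega)), ?_⟩
        rw [mul_assoc, cyc_comm_low hs i j d h2 (by omega), mul_assoc]
      · obtain rfl : j = i + 1 := by omega
        exact ⟨i, d + 1, by omega, h', hh', by rw [cyc_succ', mul_assoc]⟩
    · obtain ⟨e, rfl⟩ : ∃ e, d = e + 1 := ⟨d - 1, by omega⟩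
      refine ⟨i + 1, e, by omega, h', hh', ?_⟩
      rw [cyc_succ', mul_assoc, mul_assoc, hs.sq, mul_one]
    · obtain ⟨i, rfl⟩ : ∃ e, i = e + 1 := ⟨i - 1, by omega⟩
      refine ⟨j, d, hjd, h' * s i, mul_mem hh' (Hs_mem s (by omega)), ?_⟩
      rw [mul_assoc, cyc_shift hs i j d (by omega) (by omega) (by omega), mul_assoc]
  unfold Hs at hh
  induction hh using Subgroup.closure_induction_right with
  | one => exact ⟨k + 1, 0, by omega, 1, one_mem _, by simp [cyc]⟩
  | mul_right x hx y hy ih =>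
    obtain ⟨i, hi, rfl⟩ := hy
    exact step x i hi ih
  | mul_inv_cancel x hx y hy ih =>
    obtain ⟨i, hi, rfl⟩ := hy
    rw [show (s i)⁻¹ = s i from inv_eq_of_mul_eq_one_left (hs.sq i)]
    exact step x i hi ih

/-- `p` sends `s i` to the transposition `(i, i+1)`. -/
def IsSw {N : ℕ} (s : ℕ → G) (p : G →* Perm (Fin (N + 1))) : Prop :=
  ∀ i (h : i < N), p (s i) = swap ⟨i, by omega⟩ ⟨i + 1, by omega⟩

theorem p_fix {N : ℕ} {s : ℕ → G} {p : G →* Perm (Fin (N + 1))} (hp : IsSw s p)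
    {k : ℕ} (m : Fin (N + 1)) (hk : k < m) {h : G} (hh : h ∈ Hs s k) : p h m = m := by
  have : Hs s k ≤ (MulAction.stabilizer (Perm (Fin (N + 1))) m).comap p := by
    unfold Hs
    rw [Subgroup.closure_le]
    rintro _ ⟨i, hi, rfl⟩
    simp only [Subgroup.coe_comap, Set.mem_preimage, SetLike.mem_coe, MulAction.mem_stabilizer_iff,
      Perm.smul_def]
    have := m.2
    rw [hp i (by omega), swap_apply_of_ne_of_ne] <;> simp [Fin.ext_iff] <;> omega
  exact this hh

theorem p_cyc {N : ℕ} {s : ℕ → G} {p : G →* Perm (Fin (N + 1))} (hp : IsSw s p)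
    (j d : ℕ) (h : j + d < N + 1) : p (cyc s j d) ⟨j, by omega⟩ = ⟨j + d, h⟩ := by
  induction d with
  | zero => simp [cyc]
  | succ d ih =>
    rw [cyc, map_mul, Perm.mul_apply, ih (by omega), hp _ (by omega), swap_apply_left]
    rfl

/-- An element of the parabolic subgroup fixing the last point is in the smaller parabolic. -/
theorem mem_lower {N : ℕ} {s : ℕ → G} {p : G →* Perm (Fin (N + 1))} (hs : Cox s N) (hp : IsSw s p)
    (k : ℕ) (hk : k + 1 ≤ N) {h : G} (hh : h ∈ Hs s (k + 1))
    (hf : p h ⟨k + 1, by omega⟩ = ⟨k + 1, by omega⟩) : h ∈ Hs s k := by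
  obtain ⟨j, d, hjd, h', hh', rfl⟩ := decomp hs k hk hh
  have h1 : p (h' * cyc s j d) ⟨j, by omega⟩ = ⟨k + 1, by omega⟩ := by
    rw [map_mul, Perm.mul_apply, p_cyc hp j d (by omega)]
    simp only [hjd]
    exact p_fix hp _ (by simp) hh'
  have h2 := (p (h' * cyc s j d)).injective (h1.trans hf.symm)
  simp only [Fin.mk.injEq] at h2
  obtain rfl : d = 0 := by omega
  simpa [cyc] using hh'

theorem p_inj {N : ℕ} {s : ℕ → G} {p : G →* Perm (Fin (N + 1))} (hs : Cox s N) (hp : IsSw s p)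
    (k : ℕ) (hk : k ≤ N) {h : G} (hh : h ∈ Hs s k) (h1 : p h = 1) : h = 1 := by
  induction k with
  | zero => simpa [Hs] using hh
  | succ k ih => exact ih (by omega) (mem_lower hs hp k hk hh (by simp [h1]))

theorem perm_closure {N : ℕ} (K : Subgroup (Perm (Fin (N + 1))))
    (h : ∀ i (h : i < N), swap ⟨i, by omega⟩ ⟨i + 1, by omega⟩ ∈ K) : K = ⊤ := by
  have := Perm.mclosure_swap_castSucc_succ N
  have h2 : Submonoid.closure (Set.range fun i : Fin N ↦ swap i.castSucc i.succ) ≤ K.toSubmonoid := by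
    rw [Submonoid.closure_le]
    rintro _ ⟨i, rfl⟩
    exact h i.1 i.2
  rw [this] at h2
  rw [eq_top_iff]
  intro x _
  exact h2 (Submonoid.mem_top x)

theorem exists_rho {N : ℕ} {s : ℕ → G} {p : G →* Perm (Fin (N + 1))} (hs : Cox s N)
    (hp : IsSw s p) : ∃ ρ : Perm (Fin (N + 1)) →* G, (∀ σ, ρ σ ∈ Hs s N) ∧ (∀ σ, p (ρ σ) = σ) ∧
      ∀ h ∈ Hs s N, ρ (p h) = h := by
  let q : Hs s N →* Perm (Fin (N + 1)) := p.comp (Hs s N).subtype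
  have hq : Function.Bijective q := by
    constructor
    · rw [injective_iff_map_eq_one]
      rintro ⟨x, hx⟩ h1
      exact Subtype.ext (p_inj hs hp N le_rfl hx h1)
    · rw [← MonoidHom.range_eq_top]
      apply perm_closure
      intro i hi
      exact ⟨⟨s i, Hs_mem s hi⟩, hp i hi⟩
  let e := MulEquiv.ofBijective q hq
  refine ⟨(Hs s N).subtype.comp e.symm.toMonoidHom, fun σ => (e.symm σ).2, fun σ => ?_, ?_⟩
  · exact e.apply_symm_apply σ
  · intro h hh
    exact congrArg Subtype.val (e.symm_apply_apply ⟨h, hh⟩)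

end Coxeter

section Generic

variable {G : Type*} [Group G]

/-- The conjugates of `b`. -/
def sg (a b : G) (i : ℕ) : G := (a ^ i)⁻¹ * b * a ^ i

/-- The relations, in a convenient form. -/
structure Rels (a b : G) (N : ℕ) : Prop where
  sq : b ^ 2 = 1
  braid : (b * a * b * a⁻¹) ^ 3 = 1
  central : b * a ^ (N + 1) * b * (a ^ (N + 1))⁻¹ = 1
  comm : ∀ k, 2 ≤ k → k ≤ N + 1 - 2 → (b * a ^ k * b * (a ^ k)⁻¹) ^ 2 = 1

theorem sg_succ (a b : G) (i : ℕ) : sg a b (i + 1) = a⁻¹ * sg a b i * a := by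
  simp only [sg, pow_succ]; group

theorem a_sg (a b : G) (i : ℕ) : a * sg a b (i + 1) = sg a b i * a := by
  rw [sg_succ]; group

theorem comm_of_sq {b y : G} (hb : b * b = 1) (hy : y * y = 1) (h : (b * y) ^ 2 = 1) :
    y * b = b * y := by
  have h1 : b⁻¹ = b := inv_eq_of_mul_eq_one_left hb
  have h2 : y⁻¹ = y := inv_eq_of_mul_eq_one_left hy
  have h3 : (b * y)⁻¹ = b * y := inv_eq_of_mul_eq_one_left (by rw [← pow_two, h])
  rwa [mul_inv_rev, h1, h2] at h3

theorem braid_of_cube {b y : G} (hb : b * b = 1) (hy : y * y = 1) (h : (b * y) ^ 3 = 1) :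
    y * b * y = b * y * b := by
  have h1 : b⁻¹ = b := inv_eq_of_mul_eq_one_left hb
  have h2 : y⁻¹ = y := inv_eq_of_mul_eq_one_left hy
  have h3 : (b * y * b)⁻¹ = y * b * y := by
    apply inv_eq_of_mul_eq_one_right
    rw [← h]; simp only [pow_succ, pow_zero, one_mul, mul_assoc]
  rw [← h3]
  simp only [mul_inv_rev, h1, h2, mul_assoc]

theorem Rels.cox {a b : G} {N : ℕ} (h : Rels a b N) : Cox (sg a b) N where
  sq i := by
    have := h.sq
    calc sg a b i * sg a b i = (a ^ i)⁻¹ * b ^ 2 * a ^ i := by simp only [sg, pow_two]; group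
      _ = 1 := by rw [this]; group
  braid i := by
    have hb : b * b = 1 := by rw [← pow_two, h.sq]
    have hy : (a * b * a⁻¹) * (a * b * a⁻¹) = 1 := by
      calc (a * b * a⁻¹) * (a * b * a⁻¹) = a * (b * b) * a⁻¹ := by group
        _ = 1 := by rw [hb]; group
    have h3 := braid_of_cube hb hy (by rw [← h.braid]; simp only [mul_assoc])
    have e : sg a b i = (a ^ (i + 1))⁻¹ * (a * b * a⁻¹) * a ^ (i + 1) := by
      simp only [sg, pow_succ']; group
    calc sg a b i * sg a b (i + 1) * sg a b i
        = (a ^ (i + 1))⁻¹ * ((a * b * a⁻¹) * b * (a * b * a⁻¹)) * a ^ (i + 1) := by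
          rw [e, sg]; group
      _ = (a ^ (i + 1))⁻¹ * (b * (a * b * a⁻¹) * b) * a ^ (i + 1) := by rw [h3]
      _ = sg a b (i + 1) * sg a b i * sg a b (i + 1) := by rw [e, sg]; group
  comm i j hij hj := by
    obtain ⟨k, rfl⟩ : ∃ k, j = i + k := ⟨j - i, by omega⟩
    have hb : b * b = 1 := by rw [← pow_two, h.sq]
    have hy : (a ^ k * b * (a ^ k)⁻¹) * (a ^ k * b * (a ^ k)⁻¹) = 1 := by
      calc (a ^ k * b * (a ^ k)⁻¹) * (a ^ k * b * (a ^ k)⁻¹)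
          = a ^ k * (b * b) * (a ^ k)⁻¹ := by group
        _ = 1 := by rw [hb]; group
    have h3 := comm_of_sq hb hy (by
      rw [← h.comm k (by omega) (by omega)]; simp only [mul_assoc])
    have e : sg a b i = (a ^ (i + k))⁻¹ * (a ^ k * b * (a ^ k)⁻¹) * a ^ (i + k) := by
      simp only [sg, pow_add]; group
    calc sg a b i * sg a b (i + k)
        = (a ^ (i + k))⁻¹ * ((a ^ k * b * (a ^ k)⁻¹) * b) * a ^ (i + k) := by
          rw [e, sg]; group
      _ = (a ^ (i + k))⁻¹ * (b * (a ^ k * b * (a ^ k)⁻¹)) * a ^ (i + k) := by rw [h3]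
      _ = _ := by rw [e, sg]; group

theorem Rels.wrap {a b : G} {N : ℕ} (h : Rels a b (N + 1)) :
    a * (a * b * a⁻¹) = sg a b N * a := by
  have hb : b⁻¹ = b := inv_eq_of_mul_eq_one_left (by rw [← pow_two, h.sq])
  have h1 : b * a ^ (N + 2) * b = a ^ (N + 2) := by
    have := h.central
    rwa [mul_inv_eq_one] at this
  have h2 : a ^ (N + 2) * b = b * a ^ (N + 2) := by
    have hbb : b * b = 1 := by rw [← pow_two, h.sq]
    calc a ^ (N + 2) * b = (b * a ^ (N + 2) * b) * b := by rw [h1]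
      _ = b * a ^ (N + 2) * (b * b) := by group
      _ = _ := by rw [hbb, mul_one]
  have h3 : a * (a * b * a⁻¹) = (a ^ N)⁻¹ * (a ^ (N + 2) * b) * a⁻¹ := by
    simp only [pow_add, pow_two, mul_assoc, inv_mul_cancel_left]
  rw [h3, h2, sg, pow_add, pow_two]; group

theorem alg_comm {a S s0 c c' w q : G} (h1 : c = S * c') (h2 : c = w * s0) (hS : S * S = 1)
    (h0 : s0 * s0 = 1) (haw : a * w = c' * a) (hcw : c * w = c' * c) (hq : a * s0 = q * a)
    (hqS : a * q = S * a) (hq2 : q * q = 1) :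
    Commute (a * c⁻¹) (S * (a * c⁻¹) * S⁻¹) := by
  have iS : S⁻¹ = S := inv_eq_of_mul_eq_one_left hS
  have i0 : s0⁻¹ = s0 := inv_eq_of_mul_eq_one_left h0
  have c1 : c⁻¹ = c'⁻¹ * S := by rw [h1, mul_inv_rev, iS]
  have c2 : c⁻¹ = s0 * w⁻¹ := by rw [h2, mul_inv_rev, i0]
  have haw' : a * w⁻¹ = c'⁻¹ * a := by
    rw [mul_inv_eq_iff_eq_mul, mul_assoc, haw]; group
  have ht' : S * (a * c⁻¹) * S⁻¹ = a * a * c⁻¹ * a⁻¹ := by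
    have e1 : S * (a * c⁻¹) * S⁻¹ = S * a * c'⁻¹ := by rw [c1]; group
    have e2 : a * a * c⁻¹ = S * a * c'⁻¹ * a := by
      calc a * a * c⁻¹ = a * (a * s0) * w⁻¹ := by rw [c2]; group
        _ = (a * q) * (a * w⁻¹) := by rw [hq]; group
        _ = S * a * c'⁻¹ * a := by rw [hqS, haw']; group
    rw [e1, e2]; group
  have l1 : a * c⁻¹ = q * c'⁻¹ * a := by
    rw [c2, ← mul_assoc, hq, mul_assoc, haw', mul_assoc]
  have l2 : c⁻¹ * a = a * w⁻¹ * q := by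
    rw [c1, mul_assoc, ← hqS, ← mul_assoc, ← haw']
  have l3 : c⁻¹ * c⁻¹ = w⁻¹ * c'⁻¹ := by
    have e : c⁻¹ * c'⁻¹ = w⁻¹ * c⁻¹ := by rw [← mul_inv_rev, ← hcw, mul_inv_rev]
    calc c⁻¹ * c⁻¹ = (c⁻¹ * c'⁻¹) * S := by nth_rewrite 2 [c1]; group
      _ = w⁻¹ * c'⁻¹ * (S * S) := by rw [e, c1]; group
      _ = _ := by rw [hS, mul_one]
  have key : c⁻¹ * a * (a * c⁻¹) = a * (c⁻¹ * c⁻¹) * a := by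
    rw [l1, l2, l3]
    calc a * w⁻¹ * q * (q * c'⁻¹ * a) = a * w⁻¹ * (q * q) * c'⁻¹ * a := by group
      _ = _ := by rw [hq2]; group
  rw [ht', commute_iff_eq]
  calc a * c⁻¹ * (a * a * c⁻¹ * a⁻¹) = a * (c⁻¹ * a * (a * c⁻¹)) * a⁻¹ := by group
    _ = _ := by rw [key]; group

theorem a_cyc (a b : G) (d : ℕ) : a * cyc (sg a b) 1 d = cyc (sg a b) 0 d * a := by
  induction d with
  | zero => simp [cyc]
  | succ d ih =>
    rw [cyc, cyc, ← mul_assoc, add_comm 1 d, a_sg, mul_assoc, ih, mul_assoc, zero_add]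

theorem c_cyc {s : ℕ → G} {N : ℕ} (hs : Cox s N) (d : ℕ) (hd : d + 1 ≤ N) :
    cyc s 0 N * cyc s 1 d = cyc s 0 d * cyc s 0 N := by
  induction d with
  | zero => simp [cyc]
  | succ d ih =>
    rw [cyc, cyc, ← mul_assoc, add_comm 1 d, cyc_shift hs _ _ _ (by omega) (by omega) (by omega),
      mul_assoc, ih (by omega), mul_assoc, zero_add]

theorem rot_symm {N : ℕ} (i : ℕ) (h : i + 1 < N + 1) :
    (finRotate (N + 1)).symm ⟨i + 1, h⟩ = ⟨i, by omega⟩ := by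
  rw [Equiv.symm_apply_eq, finRotate_of_lt (by omega)]

theorem rot_symm_zero {N : ℕ} (h : 0 < N + 1) :
    (finRotate (N + 1)).symm ⟨0, h⟩ = Fin.last N := by
  rw [Equiv.symm_apply_eq, finRotate_last]; rfl

theorem p_cyc_rot {N : ℕ} {s : ℕ → G} {p : G →* Perm (Fin (N + 1))} (hp : IsSw s p)
    (d m : ℕ) (hm : m < d) (h : d < N + 1) :
    p (cyc s 0 d) ⟨m + 1, by omega⟩ = ⟨m, by omega⟩ := by
  induction d with
  | zero => omega
  | succ d ih =>
    rw [cyc, map_mul, Perm.mul_apply]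
    by_cases hmd : m < d
    · rw [ih hmd (by omega), hp _ (by omega), swap_apply_of_ne_of_ne] <;>
        simp [Fin.ext_iff] <;> omega
    · obtain rfl : m = d := by omega
      have : cyc s 0 m ∈ Hs s m := by
        have : ∀ e ≤ m, cyc s 0 e ∈ Hs s m := by
          intro e he
          induction e with
          | zero => exact one_mem _
          | succ e ih2 => exact mul_mem (Hs_mem s (by omega)) (ih2 (by omega))
        exact this m le_rfl
      rw [p_fix hp _ (by simp) this, hp _ (by omega)]
      simp only [zero_add]
      exact swap_apply_right _ _

theorem p_c {N : ℕ} {s : ℕ → G} {p : G →* Perm (Fin (N + 1))} (hp : IsSw s p) :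
    p (cyc s 0 N) = (finRotate (N + 1)).symm := by
  ext1 ⟨i, hi⟩
  cases i with
  | zero =>
    rw [p_cyc hp 0 N (by omega), rot_symm_zero]
    simp [Fin.ext_iff]
  | succ i => rw [p_cyc_rot hp N i (by omega) (by omega), rot_symm]

theorem cyc_mem (s : ℕ → G) (N : ℕ) : cyc s 0 N ∈ Hs s N := by
  have : ∀ e ≤ N, cyc s 0 e ∈ Hs s N := by
    intro e he
    induction e with
    | zero => exact one_mem _
    | succ e ih2 => exact mul_mem (Hs_mem s (by omega)) (ih2 (by omega))
  exact this N le_rfl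

theorem isSw_sg {N : ℕ} {a b : G} {p : G →* Perm (Fin (N + 2))}
    (ha : p a = (finRotate (N + 2)).symm) (hb : p b = swap ⟨0, by omega⟩ ⟨1, by omega⟩) :
    IsSw (N := N + 1) (sg a b) p := by
  intro i hi
  induction i with
  | zero => simp [sg, hb]
  | succ i ih =>
    rw [sg_succ, map_mul, map_mul, ih (by omega), map_inv, mul_assoc, inv_mul_eq_iff_eq_mul,
      mul_swap_eq_swap_mul, ha, rot_symm, rot_symm]

theorem mult_closure {α : Type*} [Fintype α] [DecidableEq α]
    (K : Subgroup (Multiplicative (α → ℤ)))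
    (h : ∀ i, Multiplicative.ofAdd (Pi.single i (1 : ℤ)) ∈ K) : K = ⊤ := by
  rw [eq_top_iff]
  intro z _
  have : z = ∏ i, (Multiplicative.ofAdd (Pi.single i (1 : ℤ)) : Multiplicative (α → ℤ)) ^
      (Multiplicative.toAdd z i) := by
    apply Multiplicative.toAdd.injective
    rw [toAdd_prod]
    simp only [toAdd_zpow, toAdd_ofAdd]
    ext j
    simp [Finset.sum_apply, Pi.single_apply]
  rw [this]
  exact Subgroup.prod_mem _ fun i _ => Subgroup.zpow_mem _ (h i) _

theorem permHom_single {α : Type*} [DecidableEq α] (σ : Perm α) (i : α) :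
    permHom α σ (Multiplicative.ofAdd (Pi.single i (1 : ℤ))) =
      Multiplicative.ofAdd (Pi.single (σ i) (1 : ℤ)) := by
  apply Multiplicative.toAdd.injective
  ext j
  change (Pi.single i (1 : ℤ) : α → ℤ) (σ.symm j) = (Pi.single (σ i) (1 : ℤ) : α → ℤ) j
  simp only [Pi.single_apply, Equiv.symm_apply_eq]

theorem exists_Phi {α : Type*} [Fintype α] [DecidableEq α] (T : α → G)
    (hT : ∀ i j, i ≠ j → Commute (T i) (T j)) :
    ∃ Φ : Multiplicative (α → ℤ) →* G,
      ∀ i, Φ (Multiplicative.ofAdd (Pi.single i (1 : ℤ))) = T i := by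
  refine ⟨(MonoidHom.noncommPiCoprod (fun i => zpowersHom G (T i)) ?_).comp
    (MulEquiv.funMultiplicative α ℤ).toMonoidHom, fun i => ?_⟩
  · intro i j hij x y
    exact ((hT i j hij).zpow_zpow _ _)
  · have : (MulEquiv.funMultiplicative α ℤ) (Multiplicative.ofAdd (Pi.single i (1 : ℤ))) =
        Pi.mulSingle i (Multiplicative.ofAdd (1 : ℤ)) := by
      ext j
      by_cases h : j = i
      · subst h; simp
      · simp [h]
    rw [MonoidHom.comp_apply]
    change MonoidHom.noncommPiCoprod _ _ (MulEquiv.funMultiplicative α ℤ _) = _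
    rw [this]
    refine (MonoidHom.noncommPiCoprod_mulSingle _ _ _).trans ?_
    simp

theorem exists_lift {N : ℕ} (hN : 2 ≤ N) {a b : G} (hr : Rels a b (N + 1))
    {p : G →* Perm (Fin (N + 2))}
    (ha : p a = (finRotate (N + 2)).symm) (hb : p b = swap ⟨0, by omega⟩ ⟨1, by omega⟩) :
    ∃ ψ : (Multiplicative (Fin (N + 2) → ℤ) ⋊[permHom (Fin (N + 2))] Perm (Fin (N + 2))) →* G,
      ψ ⟨Multiplicative.ofAdd (Pi.single (Fin.last (N + 1)) (1 : ℤ)),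
          (finRotate (N + 2)).symm⟩ = a ∧
      ψ ⟨1, swap ⟨0, by omega⟩ ⟨1, by omega⟩⟩ = b := by
  have hs := hr.cox
  have hp := isSw_sg ha hb
  obtain ⟨ρ, ρmem, pρ, ρp⟩ := exists_rho hs hp
  set s := sg a b with hsdef
  set c := cyc s 0 (N + 1) with hc
  set L := Fin.last (N + 1) with hL
  have ρc : ρ (finRotate (N + 2)).symm = c := by rw [← p_c hp, ρp _ (cyc_mem s _)]
  have ρs : ∀ i (h : i < N + 1), ρ (swap ⟨i, by omega⟩ ⟨i + 1, by omega⟩) = s i := by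
    intro i h
    rw [← hp i h, ρp _ (Hs_mem s h)]
  set t := a * c⁻¹ with ht
  have t_s : ∀ i < N, s i * t = t * s i := by
    intro i hi
    have h1 : c * s (i + 1) = s i * c := cyc_shift hs i 0 (N + 1) (by omega) (by omega) (by omega)
    have h2 : a * s (i + 1) = s i * a := a_sg a b i
    have h3 : c⁻¹ * s i = s (i + 1) * c⁻¹ := by
      rw [inv_mul_eq_iff_eq_mul, ← mul_assoc, h1]; group
    rw [ht, ← mul_assoc, ← h2, mul_assoc, mul_assoc, h3]
  have t_H : ∀ h ∈ Hs s N, h * t = t * h := by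
    have : Hs s N ≤ Subgroup.centralizer {t} := by
      unfold Hs
      rw [Subgroup.closure_le]
      rintro _ ⟨i, hi, rfl⟩
      rw [SetLike.mem_coe, Subgroup.mem_centralizer_singleton_iff]
      exact t_s i hi
    intro h hh
    exact Subgroup.mem_centralizer_singleton_iff.1 (this hh)
  have t_fix : ∀ σ : Perm (Fin (N + 2)), σ L = L → ρ σ * t = t * ρ σ := by
    intro σ hσ
    apply t_H
    apply mem_lower hs hp N le_rfl (ρmem σ)
    rw [pρ]; exact hσ
  have t_eq : ∀ σ τ : Perm (Fin (N + 2)), σ L = τ L →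
      ρ σ * t * (ρ σ)⁻¹ = ρ τ * t * (ρ τ)⁻¹ := by
    intro σ τ h
    have := t_fix (τ⁻¹ * σ) (by simp [h])
    rw [map_mul, map_inv] at this
    rw [mul_inv_eq_iff_eq_mul]
    calc ρ σ * t = ρ τ * ((ρ τ)⁻¹ * ρ σ * t) := by group
      _ = _ := by rw [this]; group
  set T : Fin (N + 2) → G := fun i => ρ (swap i L) * t * (ρ (swap i L))⁻¹ with hTdef
  have T_eq : ∀ σ : Perm (Fin (N + 2)), ρ σ * t * (ρ σ)⁻¹ = T (σ L) := by
    intro σ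
    exact t_eq _ _ (by simp)
  have T_conj : ∀ (σ : Perm (Fin (N + 2))) i, ρ σ * T i * (ρ σ)⁻¹ = T (σ i) := by
    intro σ i
    have := T_eq (σ * swap i L)
    rw [Perm.mul_apply, swap_apply_right] at this
    rw [← this, hTdef, map_mul]
    group
  have t_comm : Commute t (s N * t * (s N)⁻¹) := by
    have hq2 : (a * b * a⁻¹) * (a * b * a⁻¹) = 1 := by
      have : b * b = 1 := by rw [← pow_two, hr.sq]
      calc (a * b * a⁻¹) * (a * b * a⁻¹) = a * (b * b) * a⁻¹ := by group
        _ = 1 := by rw [this]; group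
    exact alg_comm (q := a * b * a⁻¹) (c' := cyc s 0 N) (w := cyc s 1 N) (s0 := s 0)
      (by rw [hc, cyc, zero_add]) (by rw [hc, cyc_succ']) (hs.sq N) (hs.sq 0) (a_cyc a b N)
      (c_cyc hs N le_rfl) (by simp [hsdef, sg]) hr.wrap hq2
  have hNL : (⟨N, by omega⟩ : Fin (N + 2)) ≠ L := by
    rw [hL, ne_eq, Fin.ext_iff]; simp
  have T_comm : ∀ i j, i ≠ j → Commute (T i) (T j) := by
    have h0 : Commute (T L) (T ⟨N, by omega⟩) := by
      have e1 : T L = t := by simpa using (T_eq 1).symm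
      have e2 : T ⟨N, by omega⟩ = s N * t * (s N)⁻¹ := by
        rw [← ρs N (by omega), T_eq]
        congr 1
        exact (swap_apply_right _ _).symm
      rw [e1, e2]; exact t_comm
    intro i j hij
    obtain ⟨σ, h1, h2⟩ : ∃ σ : Perm (Fin (N + 2)), σ L = i ∧ σ ⟨N, by omega⟩ = j := by
      refine ⟨swap (swap L i ⟨N, by omega⟩) j * swap L i, ?_, ?_⟩
      · rw [Perm.mul_apply, swap_apply_left, swap_apply_of_ne_of_ne _ hij]
        intro h
        apply hNL
        apply (swap L i).injective
        rw [← h, swap_apply_left]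
      · rw [Perm.mul_apply, swap_apply_left]
    rw [← h1, ← h2, ← T_conj, ← T_conj]
    exact h0.map (MulAut.conj (ρ σ)).toMonoidHom
  obtain ⟨Φ, hΦ⟩ := exists_Phi T T_comm
  have compat : ∀ σ, Φ.comp (permHom (Fin (N + 2)) σ).toMonoidHom =
      (MulAut.conj (ρ σ)).toMonoidHom.comp Φ := by
    intro σ
    apply MonoidHom.eq_of_eqOn_top
    have := mult_closure (MonoidHom.eqLocus (Φ.comp (permHom (Fin (N + 2)) σ).toMonoidHom)
      ((MulAut.conj (ρ σ)).toMonoidHom.comp Φ)) (by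
        intro i
        change Φ (permHom (Fin (N + 2)) σ _) = ρ σ * Φ _ * (ρ σ)⁻¹
        rw [permHom_single, hΦ, hΦ, T_conj])
    intro x _
    have hx : x ∈ (⊤ : Subgroup _) := Subgroup.mem_top x
    rw [← this] at hx
    exact hx
  refine ⟨SemidirectProduct.lift Φ ρ compat, ?_, ?_⟩
  · change Φ _ * ρ _ = a
    rw [hΦ, ρc]
    have e1 : T L = t := by simpa using (T_eq 1).symm
    rw [e1, ht]; group
  · change Φ _ * ρ _ = b
    rw [map_one, one_mul]
    have := ρs 0 (by omega)
    rw [hsdef] at this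
    simpa [sg] using this

end Generic

section Target

/-- The target group. -/
abbrev W (N : ℕ) : Type :=
  Multiplicative (Fin (N + 2) → ℤ) ⋊[permHom (Fin (N + 2))] Perm (Fin (N + 2))

/-- Image of `a`. -/
def WA (N : ℕ) : W N :=
  ⟨Multiplicative.ofAdd (Pi.single (Fin.last (N + 1)) (1 : ℤ)), (finRotate (N + 2)).symm⟩

/-- Image of `b`. -/
def WB (N : ℕ) : W N := ⟨1, swap ⟨0, by omega⟩ ⟨1, by omega⟩⟩

/-- Basis translations. -/
def tr {N : ℕ} (i : Fin (N + 2)) : W N :=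
  SemidirectProduct.inl (Multiplicative.ofAdd (Pi.single i (1 : ℤ)))

/-- Permutations. -/
def pe {N : ℕ} : Perm (Fin (N + 2)) →* W N := SemidirectProduct.inr

theorem pe_tr {N : ℕ} (σ : Perm (Fin (N + 2))) (i : Fin (N + 2)) :
    pe σ * tr i = tr (σ i) * pe σ := by
  unfold tr pe
  rw [← permHom_single, SemidirectProduct.inl_aut, map_inv, inv_mul_cancel_right]

theorem tr_comm {N : ℕ} (i j : Fin (N + 2)) : (tr i : W N) * tr j = tr j * tr i := by
  unfold tr
  rw [← map_mul, mul_comm, map_mul]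

theorem WA_eq (N : ℕ) : WA N = tr (Fin.last (N + 1)) * pe (finRotate (N + 2)).symm := by
  unfold WA tr pe
  rw [SemidirectProduct.mk_eq_inl_mul_inr]

theorem WB_eq (N : ℕ) : WB N = pe (swap ⟨0, by omega⟩ ⟨1, by omega⟩) := rfl

theorem WA_swap (N i : ℕ) (h : i + 1 < N + 1) :
    WA N * pe (swap ⟨i + 1, by omega⟩ ⟨i + 2, by omega⟩) =
      pe (swap ⟨i, by omega⟩ ⟨i + 1, by omega⟩) * WA N := by
  have h1 := pe_tr (swap (⟨i, by omega⟩ : Fin (N + 2)) ⟨i + 1, by omega⟩) (Fin.last (N + 1))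
  rw [swap_apply_of_ne_of_ne (by rw [ne_eq, Fin.ext_iff]; simp; omega)
    (by rw [ne_eq, Fin.ext_iff]; simp; omega)] at h1
  rw [WA_eq, ← mul_assoc, h1, mul_assoc, mul_assoc, ← map_mul, ← map_mul, mul_swap_eq_swap_mul,
    rot_symm, rot_symm]

theorem W_sg (N i : ℕ) (h : i < N + 1) :
    sg (WA N) (WB N) i = pe (swap ⟨i, by omega⟩ ⟨i + 1, by omega⟩) := by
  induction i with
  | zero => simp [sg, WB_eq]
  | succ i ih =>
    rw [sg_succ, ih (by omega), mul_assoc, inv_mul_eq_iff_eq_mul, WA_swap N i (by omega)]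

theorem W_wrap (N : ℕ) (hN : 2 ≤ N) :
    WA N * WA N * WB N = sg (WA N) (WB N) N * (WA N * WA N) := by
  have e : WA N * WA N = tr (Fin.last (N + 1)) * tr ⟨N, by omega⟩ *
      pe ((finRotate (N + 2)).symm * (finRotate (N + 2)).symm) := by
    have : (finRotate (N + 2)).symm (Fin.last (N + 1)) = ⟨N, by omega⟩ := rot_symm N (by omega)
    rw [map_mul, WA_eq]
    calc tr (Fin.last (N + 1)) * pe (finRotate (N + 2)).symm *
          (tr (Fin.last (N + 1)) * pe (finRotate (N + 2)).symm)
        = tr (Fin.last (N + 1)) * (pe (finRotate (N + 2)).symm * tr (Fin.last (N + 1))) *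
          pe (finRotate (N + 2)).symm := by group
      _ = _ := by rw [pe_tr, this]; group
  rw [W_sg N N (by omega), e, WB_eq]
  set τ : Perm (Fin (N + 2)) := swap ⟨N, by omega⟩ ⟨N + 1, by omega⟩ with hτ
  have h1 : pe τ * tr (Fin.last (N + 1)) = tr ⟨N, by omega⟩ * pe τ := by
    rw [pe_tr]; congr 2; exact swap_apply_right _ _
  have h2 : pe τ * tr ⟨N, by omega⟩ = tr (Fin.last (N + 1)) * pe τ := by
    rw [pe_tr]; congr 2; exact swap_apply_left _ _
  have h3 : (finRotate (N + 2)).symm * (finRotate (N + 2)).symm *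
      swap ⟨0, by omega⟩ ⟨1, by omega⟩ =
      τ * ((finRotate (N + 2)).symm * (finRotate (N + 2)).symm) := by
    rw [mul_swap_eq_swap_mul]
    congr 1
    have e0 : (finRotate (N + 2)).symm ⟨0, by omega⟩ = ⟨N + 1, by omega⟩ := rot_symm_zero _
    have e1 : (finRotate (N + 2)).symm ⟨1, by omega⟩ = ⟨0, by omega⟩ := rot_symm 0 _
    have e2 : (finRotate (N + 2)).symm ⟨N + 1, by omega⟩ = ⟨N, by omega⟩ := rot_symm N _
    rw [Perm.mul_apply, Perm.mul_apply, e1, e0, e2]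
  calc tr (Fin.last (N + 1)) * tr ⟨N, by omega⟩ *
      pe ((finRotate (N + 2)).symm * (finRotate (N + 2)).symm) *
      pe (swap ⟨0, by omega⟩ ⟨1, by omega⟩)
      = tr (Fin.last (N + 1)) * tr ⟨N, by omega⟩ * pe τ *
        pe ((finRotate (N + 2)).symm * (finRotate (N + 2)).symm) := by
        rw [mul_assoc, ← map_mul, h3, map_mul]; group
    _ = tr ⟨N, by omega⟩ * (tr (Fin.last (N + 1)) * pe τ) *
        pe ((finRotate (N + 2)).symm * (finRotate (N + 2)).symm) := by
        rw [tr_comm]; group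
    _ = (tr ⟨N, by omega⟩ * pe τ) * tr ⟨N, by omega⟩ *
        pe ((finRotate (N + 2)).symm * (finRotate (N + 2)).symm) := by rw [← h2]; group
    _ = _ := by rw [← h1]; group

theorem W_rels (N : ℕ) (hN : 2 ≤ N) : Rels (WA N) (WB N) (N + 1) := by
  have hsq : WB N * WB N = 1 := by rw [WB_eq, ← map_mul, swap_mul_self, map_one]
  have hinv : (WB N)⁻¹ = WB N := inv_eq_of_mul_eq_one_left hsq
  have key : ∀ (k m : ℕ), (sg (WA N) (WB N) k * WB N) ^ m = 1 →
      (WB N * WA N ^ k * WB N * (WA N ^ k)⁻¹) ^ m = 1 := by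
    intro k m h
    have : WB N * WA N ^ k * WB N * (WA N ^ k)⁻¹ =
        WA N ^ k * (sg (WA N) (WB N) k * WB N) * (WA N ^ k)⁻¹ := by
      rw [sg]; group
    rw [this, conj_pow, h]; group
  refine ⟨by rw [pow_two, hsq], ?_, ?_, ?_⟩
  · have := key 1 3 (by
      rw [W_sg N 1 (by omega), WB_eq, ← map_mul, ← map_pow]
      convert map_one (pe (N := N))
      rw [swap_comm (⟨0, by omega⟩ : Fin (N + 2)), ← orderOf_dvd_iff_pow_eq_one,
        (Perm.isThreeCycle_swap_mul_swap_same _ _ _).orderOf] <;> simp [Fin.ext_iff])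
    simpa using this
  · have h := W_wrap N hN
    have : WA N ^ (N + 2) * WB N = WB N * WA N ^ (N + 2) := by
      rw [pow_add, pow_two, mul_assoc, h, sg]; group
    rw [mul_assoc (WB N), this, ← mul_assoc, hsq]; group
  · intro k h2 hk
    apply key
    rw [W_sg N k (by omega), WB_eq, ← map_mul, ← map_pow]
    convert map_one (pe (N := N))
    rw [pow_two]
    have hd : Perm.Disjoint (swap (⟨k, by omega⟩ : Fin (N + 2)) ⟨k + 1, by omega⟩)
        (swap ⟨0, by omega⟩ ⟨1, by omega⟩) := by
      intro x
      simp only [swap_apply_def, Fin.ext_iff]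
      by_cases hx : x.1 ≤ 1
      · left
        rw [if_neg (by omega), if_neg (by omega)]
      · right
        rw [if_neg (by omega), if_neg (by omega)]
    have hc := hd.commute
    rw [← pow_two, hc.mul_pow, pow_two, pow_two, swap_mul_self, swap_mul_self, mul_one]

theorem W_closure (N : ℕ) (K : Subgroup (W N)) (hA : WA N ∈ K) (hB : WB N ∈ K) : K = ⊤ := by
  have h1 : K.comap pe = ⊤ := by
    apply perm_closure
    intro i hi
    rw [Subgroup.mem_comap, ← W_sg N i hi]
    exact mul_mem (mul_mem (inv_mem (pow_mem hA i)) hB) (pow_mem hA i)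
  have hpe : ∀ σ, pe σ ∈ K := by
    intro σ
    have : σ ∈ K.comap pe := by rw [h1]; exact Subgroup.mem_top _
    exact this
  have htL : tr (Fin.last (N + 1)) ∈ K := by
    have := mul_mem hA (inv_mem (hpe (finRotate (N + 2)).symm))
    rwa [WA_eq, mul_inv_cancel_right] at this
  have htr : ∀ i, tr i ∈ K := by
    intro i
    have := pe_tr (swap i (Fin.last (N + 1))) (Fin.last (N + 1))
    rw [swap_apply_right, ← mul_inv_eq_iff_eq_mul] at this
    rw [← this]
    exact mul_mem (mul_mem (hpe _) htL) (inv_mem (hpe _))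
  have h2 : K.comap SemidirectProduct.inl = ⊤ := mult_closure _ htr
  rw [eq_top_iff]
  intro x _
  rw [← SemidirectProduct.inl_left_mul_inr_right x]
  refine mul_mem ?_ (hpe _)
  have : x.left ∈ K.comap SemidirectProduct.inl := by rw [h2]; exact Subgroup.mem_top _
  exact this

theorem presentation_iso (N : ℕ) (hN : 2 ≤ N) :
    ∃ e : PresentedGroup (sdpRels2 (N + 2)) ≃* W N,
      e (PresentedGroup.of true) = WA N ∧ e (PresentedGroup.of false) = WB N := by
  have hW := W_rels N hN
  have hf : ∀ r ∈ sdpRels2 (N + 2), FreeGroup.lift (fun x => bif x then WA N else WB N) r = 1 := by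
    intro r hr
    rcases hr with (rfl | rfl | rfl) | ⟨k, h1, h2, rfl⟩
    · simpa using hW.sq
    · simpa using hW.braid
    · simpa using hW.central
    · simpa using hW.comm k h1 h2
  let f := PresentedGroup.toGroup hf
  have fa : f (PresentedGroup.of true) = WA N := PresentedGroup.toGroup.of hf
  have fb : f (PresentedGroup.of false) = WB N := PresentedGroup.toGroup.of hf
  have hr : Rels (PresentedGroup.of true : PresentedGroup (sdpRels2 (N + 2)))
      (PresentedGroup.of false) (N + 1) := by
    refine ⟨?_, ?_, ?_, ?_⟩
    · exact PresentedGroup.one_of_mem (rels := sdpRels2 (N + 2)) (Or.inl (Or.inl rfl))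
    · exact PresentedGroup.one_of_mem (rels := sdpRels2 (N + 2)) (Or.inl (Or.inr (Or.inl rfl)))
    · exact PresentedGroup.one_of_mem (rels := sdpRels2 (N + 2)) (Or.inl (Or.inr (Or.inr rfl)))
    · intro k h1 h2
      exact PresentedGroup.one_of_mem (rels := sdpRels2 (N + 2)) (Or.inr ⟨k, h1, h2, rfl⟩)
  obtain ⟨ψ, ψa, ψb⟩ := exists_lift hN hr (p := SemidirectProduct.rightHom.comp f)
    (by rw [MonoidHom.comp_apply, fa]; rfl) (by rw [MonoidHom.comp_apply, fb]; rfl)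
  change ψ (WA N) = _ at ψa
  change ψ (WB N) = _ at ψb
  refine ⟨MonoidHom.toMulEquiv f ψ ?_ ?_, fa, fb⟩
  · ext x
    cases x
    · simp [fb, ψb]
    · simp [fa, ψa]
  · have := W_closure N (MonoidHom.eqLocus (f.comp ψ) (MonoidHom.id _))
      (by change f (ψ _) = _; rw [ψa, fa]; rfl) (by change f (ψ _) = _; rw [ψb, fb]; rfl)
    ext1 x
    have hx : x ∈ (⊤ : Subgroup (W N)) := Subgroup.mem_top x
    rw [← this] at hx
    exact hx

end Target

end Stmt9

/-- For `n ≥ 4`, the semidirect product `ℤⁿ ⋊ Sₙ` (with `Sₙ` permuting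
coordinates) has the presentation with two generators `a, b` and relations
`b² = e`, `(baba⁻¹)³ = e`, `(ba^k b a^{-k})² = e` for `2 ≤ k ≤ n - 2`, and
`baⁿba^{-n} = e`. The isomorphism sends `a` to `((0, …, 0, 1), c)`, where
`c(k) = k - 1 mod n` is an `n`-cycle, and `b` to `(0, (1 2))`. -/
theorem stmt_9 (n : ℕ) (hn : 4 ≤ n) :
    ∃ e : PresentedGroup (sdpRels2 n) ≃*
        (Multiplicative (Fin n → ℤ) ⋊[permHom (Fin n)] Equiv.Perm (Fin n)),
      e (PresentedGroup.of true) =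
        ⟨Multiplicative.ofAdd (Pi.single (⟨n - 1, by omega⟩ : Fin n) (1 : ℤ)),
          (finRotate n).symm⟩ ∧
      e (PresentedGroup.of false) =
        ⟨1, Equiv.swap (⟨0, by omega⟩ : Fin n) (⟨1, by omega⟩ : Fin n)⟩ := by
  obtain ⟨N, rfl⟩ : ∃ N, n = N + 2 := ⟨n - 2, by omega⟩
  exact Stmt9.presentation_iso N (by omega)
end

section
/- Let n ≥ 4. In ℤⁿ ⋊ Sₙ, the elements a = ((0, …, 0, 1), c) and b = (0, (1 2)), where c is the n-cycle c(k) = k − 1 mod n, generate the whole group and satisfy the relations b² = e, (baba⁻¹)³ = e, (ba^k b a^{−k})² = e for all 2 ≤ k ≤ n − 2, and aⁿ b = b aⁿ. -/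
open Equiv in
theorem aux_key (n : ℕ) (h1 : 0 < n) (j : ℕ) (h : j + 2 < n) :
    (⟨Multiplicative.ofAdd (Pi.single (⟨n - 1, by omega⟩ : Fin n) (1 : ℤ)),
        (finRotate n).symm⟩ : Multiplicative (Fin n → ℤ) ⋊[permHom (Fin n)] Equiv.Perm (Fin n)) *
      SemidirectProduct.inr (swap (⟨j + 1, by omega⟩ : Fin n) ⟨j + 2, h⟩) =
    SemidirectProduct.inr (swap (⟨j, by omega⟩ : Fin n) ⟨j + 1, by omega⟩) *
     ⟨Multiplicative.ofAdd (Pi.single (⟨n - 1, by omega⟩ : Fin n) (1 : ℤ)),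
        (finRotate n).symm⟩ := by
  obtain ⟨n, rfl⟩ : ∃ k, n = k + 1 := ⟨n - 1, by omega⟩
  have e1 : (finRotate (n+1)).symm ⟨j + 1, by omega⟩ = ⟨j, by omega⟩ := by
    rw [Equiv.symm_apply_eq, finRotate_of_lt (by omega)]
  have e2 : (finRotate (n+1)).symm ⟨j + 2, by omega⟩ = ⟨j + 1, by omega⟩ := by
    rw [Equiv.symm_apply_eq, finRotate_of_lt (by omega)]
  apply SemidirectProduct.ext
  · rw [SemidirectProduct.mul_left, SemidirectProduct.mul_left]
    simp only [SemidirectProduct.left_inr, SemidirectProduct.right_inr, map_one, mul_one, one_mul]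
    apply Multiplicative.toAdd.injective
    funext x
    change (Pi.single _ _ : Fin (n+1) → ℤ) x = (Pi.single _ _ : Fin (n+1) → ℤ) ((swap _ _).symm x)
    simp only [Pi.single_apply, Equiv.symm_swap]
    congr 1
    rw [swap_apply_eq_iff, swap_apply_of_ne_of_ne]
    all_goals simp [Fin.ext_iff]
    all_goals omega
  · rw [SemidirectProduct.mul_right, SemidirectProduct.mul_right]
    simp only [SemidirectProduct.right_inr]
    rw [Equiv.mul_swap_eq_swap_mul, e1, e2]

theorem aux_rot (n : ℕ) (hn : 2 ≤ n) : (finRotate n) ^ n = 1 := by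
  obtain ⟨n, rfl⟩ : ∃ k, n = k + 2 := ⟨n - 2, by omega⟩
  have h := (isCycle_finRotate (n := n)).orderOf
  rw [support_finRotate, Finset.card_univ, Fintype.card_fin] at h
  have h2 := pow_orderOf_eq_one (finRotate (n + 2))
  rwa [h] at h2

/-- Let `n ≥ 4`. In `ℤⁿ ⋊ Sₙ`, the elements `a = ((0, …, 0, 1), c)` and
`b = (0, (1 2))`, where `c(k) = k - 1 mod n` is an `n`-cycle, generate the whole
group and satisfy the relations `b² = e`, `(baba⁻¹)³ = e`, `(ba^k b a^{-k})² = e`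
for all `2 ≤ k ≤ n - 2`, and `aⁿb = baⁿ`. -/
theorem stmt_13 (n : ℕ) (hn : 4 ≤ n)
    (a b : Multiplicative (Fin n → ℤ) ⋊[permHom (Fin n)] Equiv.Perm (Fin n))
    (hA : a = ⟨Multiplicative.ofAdd (Pi.single (⟨n - 1, by omega⟩ : Fin n) (1 : ℤ)),
        (finRotate n).symm⟩)
    (hB : b = ⟨1, Equiv.swap (⟨0, by omega⟩ : Fin n) (⟨1, by omega⟩ : Fin n)⟩) :
    Subgroup.closure {a, b} = ⊤ ∧
    b ^ 2 = 1 ∧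
    (b * a * b * a⁻¹) ^ 3 = 1 ∧
    (∀ k : ℕ, 2 ≤ k → k ≤ n - 2 → (b * a ^ k * b * (a ^ k)⁻¹) ^ 2 = 1) ∧
    a ^ n * b = b * a ^ n := by
  have hb : b = SemidirectProduct.inr (Equiv.swap (⟨0, by omega⟩ : Fin n) ⟨1, by omega⟩) := hB
  have key : ∀ (j : ℕ) (h : j + 2 < n),
      a * SemidirectProduct.inr (Equiv.swap (⟨j + 1, by omega⟩ : Fin n) ⟨j + 2, h⟩) =
      SemidirectProduct.inr (Equiv.swap (⟨j, by omega⟩ : Fin n) ⟨j + 1, by omega⟩) * a := by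
    intro j h
    rw [hA]
    exact aux_key n (by omega) j h
  have conj : ∀ (j : ℕ) (h : j + 1 < n),
      SemidirectProduct.inr (Equiv.swap (⟨j, by omega⟩ : Fin n) ⟨j + 1, h⟩)
        = (a ^ j)⁻¹ * b * a ^ j := by
    intro j
    induction j with
    | zero => intro h; simp [hb]
    | succ j ih =>
      intro h
      have := key j (by omega)
      rw [ih] at this
      rw [eq_inv_mul_of_mul_eq this, pow_succ]
      group
  have hright : ∀ k : ℕ, (a ^ k).right = a.right ^ k := fun k =>
    map_pow (SemidirectProduct.rightHom) a k
  have hr : (a ^ n).right = 1 := by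
    rw [hright, hA]
    change ((finRotate n)⁻¹) ^ n = 1
    rw [inv_pow, aux_rot n (by omega), inv_one]
  have hz : a ^ n = SemidirectProduct.inl (a ^ n).left := by
    apply SemidirectProduct.ext
    · simp
    · simp [hr]
  have hcomm : a * a ^ n = a ^ n * a := by rw [← pow_succ, ← pow_succ']
  have hinv : (permHom (Fin n) a.right) (a ^ n).left = (a ^ n).left := by
    have h := congrArg SemidirectProduct.left hcomm
    rw [SemidirectProduct.mul_left, SemidirectProduct.mul_left, hr, map_one, mul_comm] at h
    exact mul_right_cancel h
  have h01 : Multiplicative.toAdd (a ^ n).left ⟨1, by omega⟩ =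
      Multiplicative.toAdd (a ^ n).left ⟨0, by omega⟩ := by
    have h := congrFun (congrArg Multiplicative.toAdd hinv) ⟨0, by omega⟩
    rw [← h, hA]
    change _ = Multiplicative.toAdd (_ : Multiplicative (Fin n → ℤ)) (finRotate n _)
    congr 1
    obtain ⟨n, rfl⟩ : ∃ k, n = k + 1 := ⟨n - 1, by omega⟩
    rw [finRotate_of_lt (by omega)]
  have hcen : a ^ n * b = b * a ^ n := by
    apply SemidirectProduct.ext
    · rw [SemidirectProduct.mul_left, SemidirectProduct.mul_left, hr, hb]
      simp only [SemidirectProduct.left_inr, SemidirectProduct.right_inr, map_one, mul_one, one_mul]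
      apply Multiplicative.toAdd.injective
      funext x
      change _ = Multiplicative.toAdd (a ^ n).left (Equiv.swap _ _ x)
      by_cases h0 : x = ⟨0, by omega⟩
      · rw [h0, Equiv.swap_apply_left, h01]
      by_cases h1 : x = ⟨1, by omega⟩
      · rw [h1, Equiv.swap_apply_right, h01]
      rw [Equiv.swap_apply_of_ne_of_ne h0 h1]
    · rw [SemidirectProduct.mul_right, SemidirectProduct.mul_right, hr, mul_one, one_mul]
  have hb2 : b * b = 1 := by
    rw [hb, ← map_mul, Equiv.swap_mul_self, map_one]
  refine ⟨?_, by rw [pow_two, hb2], ?_, ?_, hcen⟩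
  · rw [eq_top_iff]
    set H := Subgroup.closure {a, b} with hH
    have ha' : a ∈ H := Subgroup.subset_closure (by simp)
    have hb' : b ∈ H := Subgroup.subset_closure (by simp)
    have hS : ∀ s : Equiv.Perm (Fin n), SemidirectProduct.inr s ∈ H := by
      clear_value H
      obtain ⟨m, rfl⟩ : ∃ k, n = k + 1 := ⟨n - 1, by omega⟩
      intro s
      have hs : s ∈ Submonoid.closure
          (Set.range fun i : Fin m ↦ Equiv.swap i.castSucc i.succ) := by
        rw [Equiv.Perm.mclosure_swap_castSucc_succ]; trivial
      induction hs using Submonoid.closure_induction with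
      | mem x hx =>
        obtain ⟨i, rfl⟩ := hx
        have := conj i.1 (by omega)
        have h2 : (a ^ i.1)⁻¹ * b * a ^ i.1 ∈ H :=
          H.mul_mem (H.mul_mem (H.inv_mem (H.pow_mem ha' _)) hb') (H.pow_mem ha' _)
        rw [← this] at h2
        exact h2
      | one => rw [map_one]; exact H.one_mem
      | mul x y _ _ hx hy => rw [map_mul]; exact H.mul_mem hx hy
    have hlast : SemidirectProduct.inl (Multiplicative.ofAdd
        (Pi.single (⟨n - 1, by omega⟩ : Fin n) (1 : ℤ))) ∈ H := by
      have h := H.mul_mem ha' (H.inv_mem (hS a.right))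
      have h3 := SemidirectProduct.inl_left_mul_inr_right a
      rw [mul_inv_eq_of_eq_mul h3.symm] at h
      rw [hA] at h
      exact h
    have hsing : ∀ i : Fin n, SemidirectProduct.inl (Multiplicative.ofAdd
        (Pi.single i (1 : ℤ))) ∈ H := by
      intro i
      have h := H.mul_mem (H.mul_mem (hS (Equiv.swap i ⟨n - 1, by omega⟩)) hlast)
        (hS (Equiv.swap i ⟨n - 1, by omega⟩)⁻¹)
      rw [← SemidirectProduct.inl_aut] at h
      convert h using 3
      apply Multiplicative.toAdd.injective
      funext x
      change (Pi.single _ _ : Fin n → ℤ) x = (Pi.single _ _ : Fin n → ℤ) (Equiv.swap _ _ x)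
      simp only [Pi.single_apply]
      congr 1
      rw [Equiv.swap_apply_eq_iff, Equiv.swap_apply_right]
    have hall : ∀ z : Fin n → ℤ, SemidirectProduct.inl (Multiplicative.ofAdd z) ∈ H := by
      intro z
      have hmem : Multiplicative.ofAdd z ∈ H.comap SemidirectProduct.inl := by
        rw [← Finset.univ_sum_single z, ofAdd_sum]
        refine Subgroup.prod_mem _ fun i _ => ?_
        have h1 : (Pi.single i (z i) : Fin n → ℤ) = z i • Pi.single i (1 : ℤ) := by
          rw [← Pi.single_smul, smul_eq_mul, mul_one]
        rw [h1, ofAdd_zsmul]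
        exact Subgroup.zpow_mem _ (Subgroup.mem_comap.2 (hsing i)) _
      exact hmem
    rintro x -
    rw [← SemidirectProduct.inl_left_mul_inr_right x]
    exact H.mul_mem (hall _) (hS _)
  · have h : b * a * b * a⁻¹ = a * (((a ^ 1)⁻¹ * b * a ^ 1) * b) * a⁻¹ := by group
    rw [h, ← conj 1 (by omega), conj_pow, hb, ← map_mul, ← map_pow]
    have : (Equiv.swap (⟨1, by omega⟩ : Fin n) ⟨1 + 1, by omega⟩ *
      Equiv.swap ⟨0, by omega⟩ ⟨1, by omega⟩) ^ 3 = 1 := by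
      have h3 := Equiv.Perm.isThreeCycle_swap_mul_swap_same
        (a := (⟨1, by omega⟩ : Fin n)) (b := ⟨1 + 1, by omega⟩) (c := ⟨0, by omega⟩)
        (by simp) (by simp) (by simp)
      rw [Equiv.swap_comm (⟨0, by omega⟩ : Fin n), ← h3.orderOf, pow_orderOf_eq_one]
    rw [this]; simp
  · intro k hk hk'
    have h : a ^ k * b * (a ^ k)⁻¹ = (a ^ (n - k))⁻¹ * b * a ^ (n - k) := by
      have hs : a ^ n = a ^ (n - k) * a ^ k := by rw [← pow_add]; congr 1; omega
      rw [hs] at hcen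
      rw [mul_inv_eq_iff_eq_mul, mul_assoc, mul_assoc, eq_inv_mul_iff_mul_eq, ← mul_assoc, hcen]
      try group
    have h2 : b * a ^ k * b * (a ^ k)⁻¹ = b * (a ^ k * b * (a ^ k)⁻¹) := by group
    rw [h2, h, ← conj (n - k) (by omega), hb, ← map_mul, ← map_pow]
    have hd : Commute (Equiv.swap (⟨0, by omega⟩ : Fin n) ⟨1, by omega⟩)
        (Equiv.swap ⟨n - k, by omega⟩ ⟨n - k + 1, by omega⟩) := by
      apply Equiv.Perm.Disjoint.commute
      apply Equiv.Perm.disjoint_swap_swap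
      simp [Fin.ext_iff]
      omega
    rw [hd.mul_pow, pow_two, pow_two, Equiv.swap_mul_self, Equiv.swap_mul_self, mul_one, map_one]
end
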